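/- For each nonnegative integer i let S_i denote the subgroup of Q_{4,2} generated by the two elements x_i and yxy, where x_i is evaluated at x = p(X), y = p(Y) and yxy = p(Y)p(X)p(Y). Then for every pair (i,j) of nonnegative integers there exists a group isomorphism η_{ij} : S_i → S_j with η_{ij}(x_i) = x_j and η_{ij}(yxy) = yxy. -/

import Mathlib

/-!
Common setup: the commutator convention `[a,b] = a⁻¹b⁻¹ab` of the paper, the sequence
`x₀ = x`, `x_{i+1} = [yxy, x_i]`, the Laurent polynomial ring `R = 𝔽₂[t,t⁻¹]`, and the
images `X`, `Y` of `σ₁σ₂σ₃` and `σ₁σ₂σ₃σ₁` in `GL(3, R)` under the mod-2 reduced Burau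
representation of the 4-strand braid group.
-/

open Matrix LaurentPolynomial

noncomputable section

set_option maxRecDepth 100000

/-- The paper's commutator convention: `[a,b] = a⁻¹b⁻¹ab`. -/
def br {G : Type*} [Group G] (a b : G) : G := a⁻¹ * b⁻¹ * a * b

/-- The recursively defined elements `x₀ = x`, `x_{i+1} = [yxy, x_i]`. -/
def xseq {G : Type*} [Group G] (x y : G) : ℕ → G
  | 0 => x
  | n + 1 => br (y * x * y) (xseq x y n)

/-- `R = 𝔽₂[t,t⁻¹]`, the ring of Laurent polynomials over the field with two elements. -/
abbrev R2 : Type := LaurentPolynomial (ZMod 2)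

instance : CharP R2 2 := charP_of_injective_algebraMap (algebraMap (ZMod 2) R2).injective 2

/-- The matrix `X = t·!![0,0,1; 1,0,1; 0,1,1]`. -/
def Xmat : Matrix (Fin 3) (Fin 3) R2 := (T 1 : R2) • !![0,0,1; 1,0,1; 0,1,1]

/-- The matrix `Y = t·!![0,0,1; t,1,1; 0,1,1]`. -/
def Ymat : Matrix (Fin 3) (Fin 3) R2 := (T 1 : R2) • !![0,0,1; T 1,1,1; 0,1,1]

/-- An explicit inverse for `Xmat`. -/
def Xmatinv : Matrix (Fin 3) (Fin 3) R2 := (T (-1) : R2) • !![1,1,0; 1,0,1; 1,0,0]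

/-- An explicit inverse for `Ymat`. -/
def Ymatinv : Matrix (Fin 3) (Fin 3) R2 := (T (-2) : R2) • !![0,1,1; T 1,0,T 1; T 1,0,0]

lemma Xmat_mul_Xmatinv : Xmat * Xmatinv = 1 := by
  rw [Xmat, Xmatinv, Matrix.smul_mul, Matrix.mul_smul, smul_smul, ← T_add]
  simp only [Matrix.mul_fin_three, mul_zero, zero_mul, mul_one, one_mul, add_zero, zero_add,
    ← T_add, CharTwo.add_self_eq_zero]
  rw [Matrix.one_fin_three]
  simp only [Matrix.smul_of, Matrix.smul_cons, smul_eq_mul, Matrix.smul_empty, ← T_add,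
    mul_zero, mul_one]
  norm_num [T_zero]

lemma Xmatinv_mul_Xmat : Xmatinv * Xmat = 1 := by
  rw [Xmat, Xmatinv, Matrix.smul_mul, Matrix.mul_smul, smul_smul, ← T_add]
  simp only [Matrix.mul_fin_three, mul_zero, zero_mul, mul_one, one_mul, add_zero, zero_add,
    ← T_add, CharTwo.add_self_eq_zero]
  rw [Matrix.one_fin_three]
  simp only [Matrix.smul_of, Matrix.smul_cons, smul_eq_mul, Matrix.smul_empty, ← T_add,
    mul_zero, mul_one]
  norm_num [T_zero]

lemma Ymat_mul_Ymatinv : Ymat * Ymatinv = 1 := by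
  rw [Ymat, Ymatinv, Matrix.smul_mul, Matrix.mul_smul, smul_smul, ← T_add]
  simp only [Matrix.mul_fin_three, mul_zero, zero_mul, mul_one, one_mul, add_zero, zero_add,
    ← T_add, CharTwo.add_self_eq_zero]
  rw [Matrix.one_fin_three]
  simp only [Matrix.smul_of, Matrix.smul_cons, smul_eq_mul, Matrix.smul_empty, ← T_add,
    mul_zero, mul_one]
  norm_num [T_zero]

lemma Ymatinv_mul_Ymat : Ymatinv * Ymat = 1 := by
  rw [Ymat, Ymatinv, Matrix.mul_smul, Matrix.smul_mul, smul_smul, ← T_add]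
  simp only [Matrix.mul_fin_three, mul_zero, zero_mul, mul_one, one_mul, add_zero, zero_add,
    ← T_add, CharTwo.add_self_eq_zero]
  rw [Matrix.one_fin_three]
  simp only [Matrix.smul_of, Matrix.smul_cons, smul_eq_mul, Matrix.smul_empty, ← T_add,
    mul_zero, mul_one]
  norm_num [T_zero]

/-- `X ∈ GL(3, 𝔽₂[t,t⁻¹])`, the mod-2 reduced Burau image of `σ₁σ₂σ₃`. -/
def X : GL (Fin 3) R2 := ⟨Xmat, Xmatinv, Xmat_mul_Xmatinv, Xmatinv_mul_Xmat⟩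

/-- `Y ∈ GL(3, 𝔽₂[t,t⁻¹])`, the mod-2 reduced Burau image of `σ₁σ₂σ₃σ₁`. -/
def Y : GL (Fin 3) R2 := ⟨Ymat, Ymatinv, Ymat_mul_Ymatinv, Ymatinv_mul_Ymat⟩

/-- `PGL(3, R)`, the projective general linear group: `GL(3,R)` modulo its center
(the subgroup of scalars). -/
abbrev PGL3 : Type := GL (Fin 3) R2 ⧸ Subgroup.center (GL (Fin 3) R2)

/-- The natural projection `p : GL(3,R) → PGL(3,R)`. -/
def pp : GL (Fin 3) R2 →* PGL3 := QuotientGroup.mk' (Subgroup.center (GL (Fin 3) R2))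

/-- `S_i`, the subgroup of `PGL(3,R)` (a subgroup of `Q_{4,2}`) generated by `x_i` and
`yxy`, evaluated at `x = p(X)`, `y = p(Y)`. -/
def Si (i : ℕ) : Subgroup PGL3 :=
  Subgroup.closure {xseq (pp X) (pp Y) i, pp Y * pp X * pp Y}


/-- Conjugating matrix. -/
def Cm {A : Type*} [CommRing A] (t : A) : Matrix (Fin 3) (Fin 3) A :=
  !![1, t+t^2+t^3, t+t^2+t^3; t^3, t, t^3; 1+t+t^2+t^3, t+t^3, 0]

lemma gen_W {A : Type*} [CommRing A] (t : A) (h2 : (2:A) = 0)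
    (M N : Matrix (Fin 3) (Fin 3) A) (hM : M = !![0,0,1; 1,0,1; 0,1,1])
    (hN : N = !![0,0,1; t,1,1; 0,1,1]) :
    Cm t * (N * M * N) = (N * M * N) * Cm t := by
  subst hM hN
  simp only [Cm, Matrix.mul_fin_three]
  ext i j
  fin_cases i <;> fin_cases j <;> simp <;> grind

lemma gen_X {A : Type*} [CommRing A] (t : A) (h2 : (2:A) = 0)
    (M N : Matrix (Fin 3) (Fin 3) A) (hM : M = !![0,0,1; 1,0,1; 0,1,1])
    (hN : N = !![0,0,1; t,1,1; 0,1,1]) :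
    M * (N * M * N) * (Cm t * M) = (N * M * N) * M * Cm t := by
  subst hM hN
  simp only [Cm, Matrix.mul_fin_three]
  ext i j
  fin_cases i <;> fin_cases j <;> simp <;> grind

lemma gen_det {A : Type*} [CommRing A] (t : A) (h2 : (2:A) = 0) :
    (Cm t).det = t^2 * (1+t)^6 := by
  simp [Cm, Matrix.det_fin_three]
  grind


lemma R2_two : (2 : R2) = 0 := CharTwo.two_eq_zero

lemma one_add_T_ne : (1 + T 1 : R2) ≠ 0 := by
  intro h
  have h1 : (1 : R2) = T 1 := CharTwo.add_eq_zero.mp h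
  rw [← T_zero] at h1
  have h2 := congrArg LaurentPolynomial.degree h1
  rw [degree_T, degree_T] at h2
  exact absurd h2 (by decide)

instance : NoZeroDivisors R2 := inferInstance

lemma det_C_ne : (Cm (T 1 : R2)).det ≠ 0 := by
  rw [gen_det _ R2_two]
  exact mul_ne_zero (pow_ne_zero _ (isUnit_T 1).ne_zero) (pow_ne_zero _ one_add_T_ne)

/-- `M`, a lift of `p(X)` of determinant one. -/
def Mmat : Matrix (Fin 3) (Fin 3) R2 := !![0,0,1; 1,0,1; 0,1,1]

lemma Xmat_eq : Xmat = (T 1 : R2) • Mmat := rfl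

/-- The scalar unit `t⁻¹`. -/
def sc : GL (Fin 3) R2 := Matrix.GeneralLinearGroup.scalar (Fin 3) (isUnit_T (R := ZMod 2) (-1)).unit

lemma sc_center : sc ∈ Subgroup.center (GL (Fin 3) R2) := by
  rw [Matrix.GeneralLinearGroup.center_eq_range_scalar]
  exact ⟨_, rfl⟩

lemma sc_X : (sc * X).val = Mmat := by
  have h : sc.val = (T (-1) : R2) • (1 : Matrix (Fin 3) (Fin 3) R2) := by
    rw [Matrix.smul_one_eq_diagonal]; rfl
  rw [Units.val_mul, h]
  change _ * Xmat = _
  rw [Xmat_eq, Matrix.smul_mul, Matrix.mul_smul, smul_smul, ← T_add, one_mul]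
  simp

lemma C_W : Cm (T 1 : R2) * (Y * X * Y).val = (Y * X * Y).val * Cm (T 1 : R2) := by
  have := gen_W (T 1 : R2) R2_two _ _ rfl rfl
  change _ * (Ymat * Xmat * Ymat) = (Ymat * Xmat * Ymat) * _
  simp only [Ymat, Xmat, Matrix.smul_mul, Matrix.mul_smul, this]

lemma C_X : Cm (T 1 : R2) * (sc * X).val = (br (Y * X * Y) X).val * Cm (T 1 : R2) := by
  have h : (X * (Y * X * Y)).val * (Cm (T 1 : R2) * (sc * X).val)
      = (X * (Y * X * Y)).val * ((br (Y * X * Y) X).val * Cm (T 1 : R2)) := by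
    rw [← mul_assoc _ (br (Y * X * Y) X).val, ← Units.val_mul]
    have e : X * (Y * X * Y) * br (Y * X * Y) X = Y * X * Y * X := by
      simp only [br]; group
    rw [e, sc_X]
    have := gen_X (T 1 : R2) R2_two _ _ rfl rfl
    change (Xmat * (Ymat * Xmat * Ymat)) * _ = (Ymat * Xmat * Ymat * Xmat) * _
    simp only [Ymat, Xmat, Mmat, Matrix.smul_mul, Matrix.mul_smul, this]
  exact (Units.mul_right_inj _).mp h

/-- Pairs in `PGL3` with lifts intertwined by `C`. -/
def Kc (C : Matrix (Fin 3) (Fin 3) R2) : Subgroup (PGL3 × PGL3) where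
  carrier := {q | ∃ G H : GL (Fin 3) R2, pp G = q.1 ∧ pp H = q.2 ∧ C * G.val = H.val * C}
  one_mem' := ⟨1, 1, by simp, by simp, by simp⟩
  mul_mem' := by
    rintro _ _ ⟨G, H, h1, h2, h3⟩ ⟨G', H', h1', h2', h3'⟩
    refine ⟨G * G', H * H', by simp [h1, h1'], by simp [h2, h2'], ?_⟩
    rw [Units.val_mul, Units.val_mul, ← mul_assoc, h3, mul_assoc, h3', mul_assoc]
  inv_mem' := by
    rintro _ ⟨G, H, h1, h2, h3⟩
    refine ⟨G⁻¹, H⁻¹, by simp [h1], by simp [h2], ?_⟩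
    rw [Units.eq_inv_mul_iff_mul_eq, ← mul_assoc, ← h3, mul_assoc, Units.mul_inv, mul_one]

lemma cancel_right {C A B : Matrix (Fin 3) (Fin 3) R2} (hC : C.det ≠ 0) (h : A * C = B * C) :
    A = B := by
  have h1 := congrArg (· * C.adjugate) h
  simp only [mul_assoc, Matrix.mul_adjugate, Matrix.mul_smul, mul_one] at h1
  exact smul_right_injective _ hC h1

lemma cancel_left {C A B : Matrix (Fin 3) (Fin 3) R2} (hC : C.det ≠ 0) (h : C * A = C * B) :
    A = B := by
  have h1 := congrArg (C.adjugate * ·) h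
  simp only [← mul_assoc, Matrix.adjugate_mul, Matrix.smul_mul, one_mul] at h1
  exact smul_right_injective _ hC h1

lemma center_comm {G : GL (Fin 3) R2} (h : pp G = 1) (C : Matrix (Fin 3) (Fin 3) R2) :
    C * G.val = G.val * C := by
  have h' : G ∈ Subgroup.center (GL (Fin 3) R2) := (QuotientGroup.eq_one_iff G).mp h
  obtain ⟨a, ha⟩ := Matrix.GeneralLinearGroup.mem_center_iff_val_mem_range_scalar.mp h'
  rw [← ha]
  exact ((Matrix.scalar_commute a (fun r => mul_comm _ _) C).eq).symm

lemma Kc_left {C : Matrix (Fin 3) (Fin 3) R2} (hC : C.det ≠ 0) {h : PGL3}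
    (hh : ((1 : PGL3), h) ∈ Kc C) : h = 1 := by
  obtain ⟨G, H, h1, h2, h3⟩ := hh
  simp only at h1 h2
  rw [center_comm h1] at h3
  have : G = H := Units.ext (cancel_right hC h3)
  rw [← h2, ← this, h1]

lemma Kc_right {C : Matrix (Fin 3) (Fin 3) R2} (hC : C.det ≠ 0) {h : PGL3}
    (hh : (h, (1 : PGL3)) ∈ Kc C) : h = 1 := by
  obtain ⟨G, H, h1, h2, h3⟩ := hh
  simp only at h1 h2
  rw [← center_comm h2] at h3
  have : G = H := Units.ext (cancel_left hC h3)
  rw [← h1, this, h2]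

lemma Kc_W : (pp Y * pp X * pp Y, pp Y * pp X * pp Y) ∈ Kc (Cm (T 1)) :=
  ⟨Y * X * Y, Y * X * Y, by simp, by simp, C_W⟩

lemma Kc_seq (i : ℕ) :
    (xseq (pp X) (pp Y) i, xseq (pp X) (pp Y) (i + 1)) ∈ Kc (Cm (T 1)) := by
  induction i with
  | zero =>
    refine ⟨sc * X, br (Y * X * Y) X, ?_, ?_, C_X⟩
    · have : pp sc = 1 := (QuotientGroup.eq_one_iff sc).mpr sc_center
      simp [this, xseq]
    · simp [br, xseq]
  | succ n ih =>
    have := Subgroup.mul_mem _ (Subgroup.mul_mem _ (Subgroup.mul_mem _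
      (Subgroup.inv_mem _ Kc_W) (Subgroup.inv_mem _ ih)) Kc_W) ih
    exact this

lemma iso_of {G : Type*} [Group G] (K : Subgroup (G × G))
    (hl : ∀ h : G, (1, h) ∈ K → h = 1) (hr : ∀ h : G, (h, 1) ∈ K → h = 1)
    (a b w : G) (hab : (a, b) ∈ K) (hw : (w, w) ∈ K) :
    ∃ η : Subgroup.closure {a, w} ≃* Subgroup.closure {b, w},
      η ⟨a, Subgroup.subset_closure (Set.mem_insert _ _)⟩ =
          ⟨b, Subgroup.subset_closure (Set.mem_insert _ _)⟩ ∧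
        η ⟨w, Subgroup.subset_closure (Set.mem_insert_of_mem _ rfl)⟩ =
          ⟨w, Subgroup.subset_closure (Set.mem_insert_of_mem _ rfl)⟩ := by
  let L : Subgroup (G × G) := Subgroup.closure {(a, b), (w, w)}
  have hL : L ≤ K := by
    rw [Subgroup.closure_le]
    rintro _ (rfl | rfl) <;> assumption
  let f : L →* G := (MonoidHom.fst G G).comp L.subtype
  let g : L →* G := (MonoidHom.snd G G).comp L.subtype
  have hf : Function.Injective f := by
    rw [injective_iff_map_eq_one]
    rintro ⟨⟨u, v⟩, huv⟩ (h : u = 1)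
    subst h
    have := hl v (hL huv)
    subst this
    rfl
  have hg : Function.Injective g := by
    rw [injective_iff_map_eq_one]
    rintro ⟨⟨u, v⟩, huv⟩ (h : v = 1)
    subst h
    have := hr u (hL huv)
    subst this
    rfl
  have rf : f.range = Subgroup.closure {a, w} := by
    rw [MonoidHom.range_comp, Subgroup.range_subtype, MonoidHom.map_closure, Set.image_pair]
    rfl
  have rg : g.range = Subgroup.closure {b, w} := by
    rw [MonoidHom.range_comp, Subgroup.range_subtype, MonoidHom.map_closure, Set.image_pair]
    rfl
  let ef : L ≃* Subgroup.closure {a, w} :=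
    (MonoidHom.ofInjective hf).trans (MulEquiv.subgroupCongr rf)
  let eg : L ≃* Subgroup.closure {b, w} :=
    (MonoidHom.ofInjective hg).trans (MulEquiv.subgroupCongr rg)
  refine ⟨ef.symm.trans eg, ?_, ?_⟩
  · have : ef ⟨(a, b), Subgroup.subset_closure (Set.mem_insert _ _)⟩ =
      ⟨a, Subgroup.subset_closure (Set.mem_insert _ _)⟩ := rfl
    rw [← this, MulEquiv.trans_apply, MulEquiv.symm_apply_apply]
    rfl
  · have : ef ⟨(w, w), Subgroup.subset_closure (Set.mem_insert_of_mem _ rfl)⟩ =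
      ⟨w, Subgroup.subset_closure (Set.mem_insert_of_mem _ rfl)⟩ := rfl
    rw [← this, MulEquiv.trans_apply, MulEquiv.symm_apply_apply]
    rfl

/-- The claim of the theorem, as a relation. -/
def Rel5 (i j : ℕ) : Prop :=
    ∃ η : Si i ≃* Si j,
      η ⟨xseq (pp X) (pp Y) i, Subgroup.subset_closure (Set.mem_insert _ _)⟩ =
          ⟨xseq (pp X) (pp Y) j, Subgroup.subset_closure (Set.mem_insert _ _)⟩ ∧
        η ⟨pp Y * pp X * pp Y, Subgroup.subset_closure (Set.mem_insert_of_mem _ rfl)⟩ =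
          ⟨pp Y * pp X * pp Y, Subgroup.subset_closure (Set.mem_insert_of_mem _ rfl)⟩

lemma Rel5_succ (i : ℕ) : Rel5 i (i + 1) :=
  iso_of (Kc (Cm (T 1))) (fun _ => Kc_left det_C_ne) (fun _ => Kc_right det_C_ne) _ _ _
    (Kc_seq i) Kc_W

lemma Rel5_symm {i j : ℕ} (h : Rel5 i j) : Rel5 j i := by
  obtain ⟨η, h1, h2⟩ := h
  exact ⟨η.symm, by rw [← h1, MulEquiv.symm_apply_apply],
    (MulEquiv.symm_apply_eq η).mpr h2.symm⟩

lemma Rel5_trans {i j k : ℕ} (h : Rel5 i j) (h' : Rel5 j k) : Rel5 i k := by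
  obtain ⟨η, h1, h2⟩ := h
  obtain ⟨θ, h3, h4⟩ := h'
  exact ⟨η.trans θ, by rw [MulEquiv.trans_apply, h1, h3], by rw [MulEquiv.trans_apply, h2, h4]⟩

lemma Rel5_zero (i : ℕ) : Rel5 0 i := by
  induction i with
  | zero => exact ⟨MulEquiv.refl _, rfl, rfl⟩
  | succ n ih => exact Rel5_trans ih (Rel5_succ n)

/-- **Lemma 2.3.** For every pair `(i,j)` there is a group isomorphism
`η_{ij} : S_i → S_j` with `η_{ij}(x_i) = x_j` and `η_{ij}(yxy) = yxy`. -/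
theorem statement5 (i j : ℕ) :
    ∃ η : Si i ≃* Si j,
      η ⟨xseq (pp X) (pp Y) i, Subgroup.subset_closure (Set.mem_insert _ _)⟩ =
          ⟨xseq (pp X) (pp Y) j, Subgroup.subset_closure (Set.mem_insert _ _)⟩ ∧
        η ⟨pp Y * pp X * pp Y, Subgroup.subset_closure (Set.mem_insert_of_mem _ rfl)⟩ =
          ⟨pp Y * pp X * pp Y, Subgroup.subset_closure (Set.mem_insert_of_mem _ rfl)⟩ :=
  Rel5_trans (Rel5_symm (Rel5_zero i)) (Rel5_zero j)
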